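/- arXiv:1701.06026 — 5 statements merged into one kernel-verified Lean document; each statement's English description precedes it below -/
import Mathlib

section
/- Let k₁, k₂ ∈ ℤⁿ be linearly independent over ℝ. Then ‖k₁‖²‖k₂‖² − ⟨k₁, k₂⟩² ≥ 1, and consequently √(‖k₁‖²‖k₂‖² − ⟨k₁, k₂⟩²) / (‖k₁‖‖k₂‖) ≥ 1/(|k₁| |k₂|). -/
/-- The Euclidean norm is at most the `ℓ¹`-norm. -/
theorem sqrt_sum_sq_le_sum_abs {ι : Type*} [Fintype ι] (x : ι → ℝ) :
    √(∑ i, x i ^ 2) ≤ ∑ i, |x i| := by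
  refine Real.sqrt_le_iff.mpr ⟨Finset.sum_nonneg fun i _ => abs_nonneg _, ?_⟩
  simpa only [sq_abs] using
    Finset.sum_sq_le_sq_sum_of_nonneg (s := Finset.univ) (f := fun i => |x i|)
      fun i _ => abs_nonneg _

/-- The Gram determinant of two linearly independent real vectors is positive. -/
theorem gram_pos_of_linearIndependent {ι : Type*} [Fintype ι] (x y : ι → ℝ)
    (h : LinearIndependent ℝ ![x, y]) :
    0 < (∑ i, x i ^ 2) * (∑ i, y i ^ 2) - (∑ i, x i * y i) ^ 2 := by
  set A := ∑ i, x i ^ 2 with hA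
  set B := ∑ i, y i ^ 2 with hB
  set C := ∑ i, x i * y i with hC
  have hA0 : A ≠ 0 := by
    intro h0
    refine h.ne_zero 0 (funext fun i => ?_)
    have := (Finset.sum_eq_zero_iff_of_nonneg fun i _ => sq_nonneg (x i)).mp h0 i
      (Finset.mem_univ i)
    simpa using this
  have hApos : 0 < A := (Finset.sum_nonneg fun i _ => sq_nonneg (x i)).lt_of_ne' hA0
  have hsum : ∑ i, (A * y i - C * x i) ^ 2 = A * (A * B - C ^ 2) := by
    calc ∑ i, (A * y i - C * x i) ^ 2
        = ∑ i, (A ^ 2 * y i ^ 2 - 2 * A * C * (x i * y i) + C ^ 2 * x i ^ 2) :=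
          Finset.sum_congr rfl fun i _ => by ring
      _ = A ^ 2 * B - 2 * A * C * C + C ^ 2 * A := by
          rw [Finset.sum_add_distrib, Finset.sum_sub_distrib, ← Finset.mul_sum,
            ← Finset.mul_sum, ← Finset.mul_sum]
      _ = A * (A * B - C ^ 2) := by ring
  have hnonneg : 0 ≤ ∑ i, (A * y i - C * x i) ^ 2 := Finset.sum_nonneg fun i _ => sq_nonneg _
  refine pos_of_mul_pos_right (hsum ▸ hnonneg.lt_of_ne' fun h0 => hA0 ?_) hApos.le
  refine (LinearIndependent.pair_iff.mp h (-C) A (funext fun i => ?_)).2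
  have hi := (Finset.sum_eq_zero_iff_of_nonneg fun i _ => sq_nonneg (A * y i - C * x i)).mp h0 i
    (Finset.mem_univ i)
  have hi' := pow_eq_zero_iff two_ne_zero |>.mp hi
  simp only [Pi.add_apply, Pi.smul_apply, smul_eq_mul, Pi.zero_apply]
  linarith


/-- **Angle lower bound for independent integer vectors.** For ℝ-linearly independent
`k₁, k₂ ∈ ℤⁿ` one has `‖k₁‖²‖k₂‖² − ⟨k₁,k₂⟩² ≥ 1`, hence
`sin ∠(k₁,k₂) ≥ 1/(|k₁|₁ |k₂|₁)`. -/
theorem integer_angle_bound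
    (n : ℕ) (k₁ k₂ : Fin n → ℤ)
    (hind : LinearIndependent ℝ ![(fun i => (k₁ i : ℝ)), (fun i => (k₂ i : ℝ))]) :
    1 ≤ (∑ i, (k₁ i : ℝ) ^ 2) * (∑ i, (k₂ i : ℝ) ^ 2) -
        (∑ i, (k₁ i : ℝ) * (k₂ i : ℝ)) ^ 2 ∧
    1 / ((∑ i, |(k₁ i : ℝ)|) * (∑ i, |(k₂ i : ℝ)|)) ≤
      Real.sqrt ((∑ i, (k₁ i : ℝ) ^ 2) * (∑ i, (k₂ i : ℝ) ^ 2) -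
          (∑ i, (k₁ i : ℝ) * (k₂ i : ℝ)) ^ 2) /
        (Real.sqrt (∑ i, (k₁ i : ℝ) ^ 2) * Real.sqrt (∑ i, (k₂ i : ℝ) ^ 2)) := by
  have hgram : 0 < (∑ i, (k₁ i : ℝ) ^ 2) * (∑ i, (k₂ i : ℝ) ^ 2) -
      (∑ i, (k₁ i : ℝ) * (k₂ i : ℝ)) ^ 2 := gram_pos_of_linearIndependent _ _ hind
  have hone : 1 ≤ (∑ i, (k₁ i : ℝ) ^ 2) * (∑ i, (k₂ i : ℝ) ^ 2) -
      (∑ i, (k₁ i : ℝ) * (k₂ i : ℝ)) ^ 2 := by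
    have hint : 0 < (∑ i, k₁ i ^ 2) * (∑ i, k₂ i ^ 2) - (∑ i, k₁ i * k₂ i) ^ 2 := by
      exact_mod_cast hgram
    exact_mod_cast Int.add_one_le_iff.mpr hint
  refine ⟨hone, ?_⟩
  have hprod : 0 < (∑ i, (k₁ i : ℝ) ^ 2) * (∑ i, (k₂ i : ℝ) ^ 2) := by
    nlinarith [sq_nonneg (∑ i, (k₁ i : ℝ) * (k₂ i : ℝ))]
  have hnorm : 0 < √(∑ i, (k₁ i : ℝ) ^ 2) * √(∑ i, (k₂ i : ℝ) ^ 2) := by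
    rw [← Real.sqrt_mul (Finset.sum_nonneg fun i _ => sq_nonneg _)]
    exact Real.sqrt_pos.mpr hprod
  refine div_le_div₀ (Real.sqrt_nonneg _) (Real.one_le_sqrt.mpr hone) hnorm ?_
  exact mul_le_mul (sqrt_sum_sq_le_sum_abs _) (sqrt_sum_sq_le_sum_abs _)
    (Real.sqrt_nonneg _) (Finset.sum_nonneg fun i _ => abs_nonneg _)
end

section
/- Let k₁, k₂ ∈ ℝⁿ \ {0} be linearly independent, and let ω ∈ ℝⁿ satisfy ⟨k₂, ω⟩ = 0. If dist(ω, R_{k₁}) ≤ α (Euclidean distance), then dist(ω, R_{k₁} ∩ R_{k₂}) ≤ α ‖k₁‖‖k₂‖ / √(‖k₁‖²‖k₂‖² − ⟨k₁, k₂⟩²). -/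
open scoped RealInnerProductSpace

section

variable {E : Type*} [NormedAddCommGroup E] [InnerProductSpace ℝ E]

theorem abs_inner_le_norm_mul_infDist (k x : E) :
    |⟪k, x⟫| ≤ ‖k‖ * Metric.infDist x {v : E | ⟪k, v⟫ = 0} := by
  rcases eq_or_ne k 0 with rfl | hk
  · simp
  have hpos : 0 < ‖k‖ := norm_pos_iff.mpr hk
  rw [mul_comm, ← div_le_iff₀ hpos]
  refine (Metric.le_infDist ⟨0, by simp⟩).mpr fun v hv => ?_
  have hv' : ⟪k, v⟫ = 0 := hv
  have hsub : ⟪k, x⟫ = ⟪k, x - v⟫ := by rw [inner_sub_right, hv', sub_zero]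
  rw [div_le_iff₀ hpos, hsub, dist_eq_norm, mul_comm]
  exact abs_real_inner_le_norm k (x - v)

theorem norm_smul_sub_inner_smul_sq (k l : E) :
    ‖‖l‖ ^ 2 • k - ⟪k, l⟫ • l‖ ^ 2 = ‖l‖ ^ 2 * (‖k‖ ^ 2 * ‖l‖ ^ 2 - ⟪k, l⟫ ^ 2) := by
  rw [norm_sub_sq_real, norm_smul, norm_smul, inner_smul_left, inner_smul_right, mul_pow, mul_pow]
  simp only [Real.norm_eq_abs, sq_abs, conj_trivial]
  ring

theorem LinearIndependent.norm_sq_mul_norm_sq_sub_inner_sq_pos {k l : E}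
    (h : LinearIndependent ℝ ![k, l]) : 0 < ‖k‖ ^ 2 * ‖l‖ ^ 2 - ⟪k, l⟫ ^ 2 := by
  have hl : 0 < ‖l‖ ^ 2 := pow_pos (norm_pos_iff.mpr (h.ne_zero 1)) 2
  have hu : ‖l‖ ^ 2 • k - ⟪k, l⟫ • l ≠ 0 := fun h0 =>
    hl.ne' (LinearIndependent.pair_iff.mp h _ (-⟪k, l⟫) (by rwa [neg_smul, ← sub_eq_add_neg])).1
  have hsq := pow_pos (norm_pos_iff.mpr hu) 2
  rw [norm_smul_sub_inner_smul_sq] at hsq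
  exact pos_of_mul_pos_right hsq hl.le

theorem infDist_inter_le_of_inner_eq_zero {k l x : E}
    (h : LinearIndependent ℝ ![k, l]) (hx : ⟪l, x⟫ = 0) :
    Metric.infDist x ({v : E | ⟪k, v⟫ = 0} ∩ {v : E | ⟪l, v⟫ = 0}) ≤
      |⟪k, x⟫| * ‖l‖ / Real.sqrt (‖k‖ ^ 2 * ‖l‖ ^ 2 - ⟪k, l⟫ ^ 2) := by
  have hD := h.norm_sq_mul_norm_sq_sub_inner_sq_pos
  have hnorm := norm_smul_sub_inner_smul_sq k l
  have hku : ⟪k, ‖l‖ ^ 2 • k - ⟪k, l⟫ • l⟫ = ‖k‖ ^ 2 * ‖l‖ ^ 2 - ⟪k, l⟫ ^ 2 := by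
    rw [inner_sub_right, inner_smul_right, inner_smul_right, real_inner_self_eq_norm_sq]
    ring
  have hlu : ⟪l, ‖l‖ ^ 2 • k - ⟪k, l⟫ • l⟫ = 0 := by
    rw [inner_sub_right, inner_smul_right, inner_smul_right, real_inner_self_eq_norm_sq,
      real_inner_comm]
    ring
  generalize ‖l‖ ^ 2 • k - ⟪k, l⟫ • l = u at hnorm hku hlu
  generalize ‖k‖ ^ 2 * ‖l‖ ^ 2 - ⟪k, l⟫ ^ 2 = D at *
  have hmem : x - (⟪k, x⟫ / D) • u ∈ {v : E | ⟪k, v⟫ = 0} ∩ {v : E | ⟪l, v⟫ = 0} := by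
    constructor
    · simp only [Set.mem_ofPred_eq, inner_sub_right, inner_smul_right, hku]
      field_simp
      ring
    · simp only [Set.mem_ofPred_eq, inner_sub_right, inner_smul_right, hlu, hx]
      ring
  refine (Metric.infDist_le_dist_of_mem hmem).trans_eq ?_
  have hu : ‖u‖ = ‖l‖ * Real.sqrt D := by
    rw [← Real.sqrt_sq (norm_nonneg u), hnorm, Real.sqrt_mul (sq_nonneg _),
      Real.sqrt_sq (norm_nonneg l)]
  rw [dist_eq_norm, sub_sub_cancel, norm_smul, hu, norm_div, Real.norm_eq_abs,
    Real.norm_of_nonneg hD.le]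
  have hs : 0 < Real.sqrt D := Real.sqrt_pos.mpr hD
  rw [div_mul_eq_mul_div, div_eq_div_iff hD.ne' hs.ne']
  linear_combination |⟪k, x⟫| * ‖l‖ * Real.mul_self_sqrt hD.le

end

/-- **Projection to a double resonance.** If `⟨k₂, ω⟩ = 0` and `ω` is `α`-close to the
hyperplane `R_{k₁}`, then `ω` is `α‖k₁‖‖k₂‖/√(‖k₁‖²‖k₂‖² − ⟨k₁,k₂⟩²)`-close to
`R_{k₁} ∩ R_{k₂}` (Euclidean distances). -/
theorem double_resonance_projection
    (n : ℕ) (k₁ k₂ ω : EuclideanSpace ℝ (Fin n))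
    (hk₁ : k₁ ≠ 0) (hk₂ : k₂ ≠ 0)
    (hind : LinearIndependent ℝ ![k₁, k₂])
    (hω : ⟪k₂, ω⟫ = 0) (α : ℝ)
    (hdist : Metric.infDist ω {v : EuclideanSpace ℝ (Fin n) | ⟪k₁, v⟫ = 0} ≤ α) :
    Metric.infDist ω
        ({v : EuclideanSpace ℝ (Fin n) | ⟪k₁, v⟫ = 0} ∩
          {v : EuclideanSpace ℝ (Fin n) | ⟪k₂, v⟫ = 0}) ≤
      α * ‖k₁‖ * ‖k₂‖ / Real.sqrt (‖k₁‖ ^ 2 * ‖k₂‖ ^ 2 - ⟪k₁, k₂⟫ ^ 2) := by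
  refine (infDist_inter_le_of_inner_eq_zero hind hω).trans ?_
  gcongr
  rw [mul_comm α]
  exact (abs_inner_le_norm_mul_infDist k₁ ω).trans (by gcongr)
end

section
/- Let l, m > 0, and let h, h₁ : ℝⁿ → ℝ be twice differentiable at a point I ∈ ℝⁿ. Suppose that for every unit vector v ∈ ℝⁿ, either ⟨∇²h(I)v, v⟩ ≥ m or |⟨∇h(I), v⟩| > l. If ‖∇h₁(I) − ∇h(I)‖ ≤ l/2 and the operator norm of ∇²h₁(I) − ∇²h(I) is at most m/2, then for every unit vector v ∈ ℝⁿ, either ⟨∇²h₁(I)v, v⟩ ≥ m/2 or |⟨∇h₁(I), v⟩| > l/2. -/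
open scoped RealInnerProductSpace

section

variable {E : Type*} [NormedAddCommGroup E] [InnerProductSpace ℝ E]

lemma abs_inner_sub_inner_le (x y : E) {v : E} (hv : ‖v‖ = 1) :
    |inner ℝ x v - inner ℝ y v| ≤ ‖x - y‖ := by
  simpa [← inner_sub_left, hv] using abs_real_inner_le_norm (x - y) v

lemma abs_inner_apply_sub_inner_apply_le (A B : E →L[ℝ] E) {v : E} (hv : ‖v‖ = 1) :
    |inner ℝ (A v) v - inner ℝ (B v) v| ≤ ‖A - B‖ :=
  (abs_inner_sub_inner_le (A v) (B v) hv).trans <| (A - B).unit_le_opNorm v hv.le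

end

/-- **Stability of quasi-convexity under perturbation.** If at `I` every unit vector `v`
satisfies `⟨∇²h(I)v, v⟩ ≥ m` or `|⟨∇h(I), v⟩| > l`, and `∇h₁, ∇²h₁` differ from
`∇h, ∇²h` by at most `l/2`, `m/2` respectively, then every unit vector `v` satisfies
`⟨∇²h₁(I)v, v⟩ ≥ m/2` or `|⟨∇h₁(I), v⟩| > l/2`. -/
theorem quasiconvexity_perturbation
    (n : ℕ) (l m : ℝ) (hl : 0 < l) (hm : 0 < m)
    (h h₁ : EuclideanSpace ℝ (Fin n) → ℝ) (I : EuclideanSpace ℝ (Fin n))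
    (hdh : DifferentiableAt ℝ h I) (hdh2 : DifferentiableAt ℝ (gradient h) I)
    (hdh₁ : DifferentiableAt ℝ h₁ I) (hdh₁2 : DifferentiableAt ℝ (gradient h₁) I)
    (hdich : ∀ v : EuclideanSpace ℝ (Fin n), ‖v‖ = 1 →
      m ≤ ⟪fderiv ℝ (gradient h) I v, v⟫ ∨ l < |(⟪gradient h I, v⟫ : ℝ)|)
    (hgrad : ‖gradient h₁ I - gradient h I‖ ≤ l / 2)
    (hhess : ‖fderiv ℝ (gradient h₁) I - fderiv ℝ (gradient h) I‖ ≤ m / 2) :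
    ∀ v : EuclideanSpace ℝ (Fin n), ‖v‖ = 1 →
      m / 2 ≤ ⟪fderiv ℝ (gradient h₁) I v, v⟫ ∨ l / 2 < |(⟪gradient h₁ I, v⟫ : ℝ)| := by
  intro v hv
  refine (hdich v hv).imp (fun hA => ?_) (fun hG => ?_)
  · have key := (abs_inner_apply_sub_inner_apply_le (fderiv ℝ (gradient h₁) I)
      (fderiv ℝ (gradient h) I) hv).trans hhess
    linarith [(abs_le.mp key).1]
  · have key := (abs_inner_sub_inner_le (gradient h₁ I) (gradient h I) hv).trans hgrad
    rw [abs_sub_comm] at key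
    linarith [abs_sub_abs_le_abs_sub (inner ℝ (gradient h I) v) (inner ℝ (gradient h₁ I) v)]
end

section
/- Let Q be a positive integer, let K ≥ 1 be a real number with K² < Q, and let m ∈ ℤ. Then at most one of the two rational numbers m/Q and (m+1)/Q has denominator (in lowest terms) at most K. -/
/-- **At most one small denominator among consecutive fractions.** If `K ≥ 1` and
`K² < Q`, then at most one of `m/Q` and `(m+1)/Q` has denominator (in lowest terms)
at most `K`. -/
theorem at_most_one_small_denominator
    (Q : ℕ) (hQ : 0 < Q) (K : ℝ) (hK : 1 ≤ K) (hKQ : K ^ 2 < (Q : ℝ)) (m : ℤ) :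
    ¬ (((((m : ℚ) / (Q : ℚ)).den : ℝ) ≤ K) ∧
       (((((m + 1 : ℤ) : ℚ) / (Q : ℚ)).den : ℝ) ≤ K)) := by
  rintro ⟨hr, hs⟩
  set r : ℚ := (m : ℚ) / (Q : ℚ) with hr_def
  set s : ℚ := ((m + 1 : ℤ) : ℚ) / (Q : ℚ) with hs_def
  have hdiff : s - r = (Q : ℚ)⁻¹ := by
    rw [hr_def, hs_def]
    push_cast
    ring
  have hdvd : Q ∣ s.den * r.den := by
    have h := Rat.sub_den_dvd s r
    rwa [hdiff, Rat.inv_natCast_den_of_pos hQ] at h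
  have hle : (Q : ℝ) ≤ s.den * r.den := by
    exact_mod_cast Nat.le_of_dvd (Nat.mul_pos s.den_pos r.den_pos) hdvd
  have hmul : (s.den : ℝ) * r.den ≤ K * K := by gcongr
  linarith [sq K]
end

section
/- Let n ≥ 2, let K ≥ 1 be a real number, let p, q ∈ ℤ be coprime with |q| > K, let i ≠ j be indices in {1, …, n}, and let k₂ = q e_i + p e_j ∈ ℤⁿ, where e_i denotes the i-th standard basis vector. Then for every k₁ ∈ ℤⁿ \ {0} with |k₁| ≤ K (ℓ¹-norm), the vectors k₁ and k₂ are linearly independent over ℝ. -/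
/-- **Independence from low-order resonances.** If `gcd(p,q) = 1`, `|q| > K ≥ 1`, and
`k₂ = q eᵢ + p eⱼ` with `i ≠ j`, then `k₂` is ℝ-linearly independent from every nonzero
integer vector `k₁` of `ℓ¹`-norm at most `K`. -/
theorem low_order_independent
    (n : ℕ) (hn : 2 ≤ n) (K : ℝ) (hK : 1 ≤ K)
    (p q : ℤ) (hpq : Int.gcd p q = 1) (hq : K < |(q : ℝ)|)
    (i j : Fin n) (hij : i ≠ j)
    (k₂ : Fin n → ℤ) (hk₂ : k₂ = Pi.single i q + Pi.single j p) :
    ∀ k₁ : Fin n → ℤ, k₁ ≠ 0 → (∑ t, |(k₁ t : ℝ)|) ≤ K →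
      LinearIndependent ℝ ![(fun t => (k₁ t : ℝ)), (fun t => (k₂ t : ℝ))] := by
  intro k₁ hk₁ hnorm
  have hq0 : q ≠ 0 := by
    rintro rfl
    norm_num at hq
    linarith
  have hqR : (q : ℝ) ≠ 0 := by exact_mod_cast hq0
  rw [LinearIndependent.pair_iff]
  intro a b hab
  have hcoord : ∀ t, a * (k₁ t : ℝ) + b * (k₂ t : ℝ) = 0 := fun t => by
    simpa using congrFun hab t
  have hk₂i : k₂ i = q := by simp [hk₂, hij]
  have hk₂j : k₂ j = p := by simp [hk₂, hij.symm]
  have hi := hcoord i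
  have hj := hcoord j
  rw [hk₂i] at hi
  rw [hk₂j] at hj
  have ha : a = 0 := by
    by_contra ha
    have hcross : k₁ i * p = q * k₁ j := by
      have h : a * ((k₁ i : ℝ) * p - q * k₁ j) = 0 := by
        linear_combination (p : ℝ) * hi - (q : ℝ) * hj
      have h' := sub_eq_zero.mp ((mul_eq_zero.mp h).resolve_left ha)
      exact_mod_cast h'
    have hdvd : q ∣ k₁ i :=
      Int.dvd_of_dvd_mul_left_of_gcd_one ⟨k₁ j, hcross⟩ (by rwa [Int.gcd_comm])
    have hlt : |k₁ i| < |q| := by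
      have h := Finset.single_le_sum (f := fun t => |(k₁ t : ℝ)|)
        (fun t _ => abs_nonneg _) (Finset.mem_univ i)
      have h' : |(k₁ i : ℝ)| < |(q : ℝ)| := (h.trans hnorm).trans_lt hq
      exact_mod_cast h'
    have hi0 : k₁ i = 0 := Int.eq_zero_of_abs_lt_dvd ((abs_dvd q _).mpr hdvd) hlt
    have hj0 : k₁ j = 0 := by
      rw [hi0, zero_mul] at hcross
      exact (mul_eq_zero.mp hcross.symm).resolve_left hq0
    apply hk₁
    funext t
    by_cases hti : t = i
    · rw [hti, hi0, Pi.zero_apply]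
    by_cases htj : t = j
    · rw [htj, hj0, Pi.zero_apply]
    have ht := hcoord t
    have hk₂t : k₂ t = 0 := by simp [hk₂, hti, htj]
    simpa [hk₂t, ha] using ht
  refine ⟨ha, ?_⟩
  rw [ha, zero_mul, zero_add] at hi
  exact (mul_eq_zero.mp hi).resolve_right hqR
end
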